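/- Let T ≠ 0 and C be real constants, let φ : ℝ → ℝ be smooth with φ'(U) > 0 for all U, and let f, f₁ : ℝ → ℝ be smooth. Define F(U) = φ'(U)·f(φ(U)) + C·φ''(U)/(4T²·φ'(U)) and F₁(U) = φ'(U)²·f₁(φ(U)) − (2F(U)φ''(U) − φ'''(U))/(4T²φ'(U)) − (6T² − C)·φ''(U)²/(16T⁴φ'(U)²) − (1 − φ'(U)²)/(2T). For a function h of one variable and a function k of one variable, let g_{h,k} denote the symmetric bilinear form field on ℝ³ given at the point (u,w,x) on tangent vectors X = (X_u,X_w,X_x), Y = (Y_u,Y_w,Y_x) by g_{h,k}(X,Y) = 2(2Tx·X_u + X_w)(2Tx·Y_u + Y_w) − X_u·Y_x − Y_u·X_x − 2a_{h,k}(u,w,x)·X_u·Y_u, where a_{h,k}(u,w,x) = (1 − e^{4Tw})/(2T) + (2T² − C)x² − 2x·h(u) + k(u). Define Φ : ℝ³ → ℝ³ by Φ(U,W,X) = (φ(U), W − log(φ'(U))/(2T), X/φ'(U) + φ''(U)/(4T²φ'(U)²)). Then Φ pulls back g_{f,f₁} to g_{F,F₁}: for every p ∈ ℝ³ and all X, Y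 ∈ ℝ³, g_{f,f₁} at Φ(p) evaluated on (DΦ_p X, DΦ_p Y) equals g_{F,F₁} at p evaluated on (X,Y), where DΦ_p is the Fréchet derivative of Φ at p. -/

import Mathlib

open Real

/-- The metric function `a = (1 − e^{4Tw})/(2T) + (2T² − C)x² − 2x·h(u) + k(u)`,
at the point `p = (u, w, x)`. -/
noncomputable def aMet (T C : ℝ) (h k : ℝ → ℝ) (p : ℝ × ℝ × ℝ) : ℝ :=
  (1 - exp (4 * T * p.2.1)) / (2 * T) + (2 * T ^ 2 - C) * p.2.2 ^ 2
    - 2 * p.2.2 * h p.1 + k p.1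

/-- The type D, CH₁ metric `2(2Tx du + dw)² − 2 du (dx + a du)` as a field of symmetric
bilinear forms on `ℝ³`, at the point `p = (u,w,x)` on tangent vectors
`X = (X_u, X_w, X_x)` and `Y = (Y_u, Y_w, Y_x)`. -/
noncomputable def gMet (T C : ℝ) (h k : ℝ → ℝ) (p X Y : ℝ × ℝ × ℝ) : ℝ :=
  2 * (2 * T * p.2.2 * X.1 + X.2.1) * (2 * T * p.2.2 * Y.1 + Y.2.1)
    - X.1 * Y.2.2 - Y.1 * X.2.2 - 2 * aMet T C h k p * X.1 * Y.1

/-- The form-preserving coordinate transformation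
`u = φ(U)`, `w = W − log φ'(U)/(2T)`, `x = X/φ'(U) + φ''(U)/(4T²φ'(U)²)`. -/
noncomputable def Φmap (T : ℝ) (φ : ℝ → ℝ) (p : ℝ × ℝ × ℝ) : ℝ × ℝ × ℝ :=
  (φ p.1,
   p.2.1 - log (deriv φ p.1) / (2 * T),
   p.2.2 / deriv φ p.1 + deriv (deriv φ) p.1 / (4 * T ^ 2 * (deriv φ p.1) ^ 2))

/-- The transformed free function `F(U) = φ'(U)·f(φ(U)) + C·φ''(U)/(4T²·φ'(U))`. -/
noncomputable def Ftrans (T C : ℝ) (φ f : ℝ → ℝ) (U : ℝ) : ℝ :=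
  deriv φ U * f (φ U) + C * deriv (deriv φ) U / (4 * T ^ 2 * deriv φ U)

/-- The transformed free function `F₁(U) = φ'²·f₁(φ(U)) − (2Fφ'' − φ''')/(4T²φ')
− (6T² − C)·φ''²/(16T⁴φ'²) − (1 − φ'²)/(2T)`. -/
noncomputable def F₁trans (T C : ℝ) (φ f f₁ : ℝ → ℝ) (U : ℝ) : ℝ :=
  (deriv φ U) ^ 2 * f₁ (φ U)
    - (2 * Ftrans T C φ f U * deriv (deriv φ) U - deriv (deriv (deriv φ)) U)
        / (4 * T ^ 2 * deriv φ U)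
    - (6 * T ^ 2 - C) * (deriv (deriv φ) U) ^ 2 / (16 * T ^ 4 * (deriv φ U) ^ 2)
    - (1 - (deriv φ U) ^ 2) / (2 * T)

/-- The Fréchet derivative of `Φ`, with `φ'` nonvanishing. -/
theorem fderiv_Φmap_apply {T : ℝ} (hT : T ≠ 0) {φ : ℝ → ℝ} (hφ : ContDiff ℝ (⊤ : ℕ∞) φ)
    (p X : ℝ × ℝ × ℝ) (hp : deriv φ p.1 ≠ 0) :
    fderiv ℝ (Φmap T φ) p X =
      (deriv φ p.1 * X.1,
       X.2.1 - deriv (deriv φ) p.1 / (2 * T * deriv φ p.1) * X.1,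
       X.2.2 / deriv φ p.1 + (-p.2.2 * deriv (deriv φ) p.1 / deriv φ p.1 ^ 2
         + deriv (deriv (deriv φ)) p.1 / (4 * T ^ 2 * deriv φ p.1 ^ 2)
         - deriv (deriv φ) p.1 ^ 2 / (2 * T ^ 2 * deriv φ p.1 ^ 3)) * X.1) := by
  have hφ₁ : ContDiff ℝ (⊤ : ℕ∞) (deriv φ) := (contDiff_infty_iff_deriv.1 hφ).2
  have hφ₂ : ContDiff ℝ (⊤ : ℕ∞) (deriv (deriv φ)) := (contDiff_infty_iff_deriv.1 hφ₁).2
  have hd {g : ℝ → ℝ} {g' : ℝ} (hg : HasDerivAt g g' p.1) :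
      HasFDerivAt (fun q : ℝ × ℝ × ℝ => g q.1)
        (g' • ContinuousLinearMap.fst ℝ ℝ (ℝ × ℝ)) p :=
    hg.comp_hasFDerivAt p hasFDerivAt_fst
  have h₀ := ((contDiff_infty_iff_deriv.1 hφ).1 p.1).hasDerivAt
  have h₁ := ((contDiff_infty_iff_deriv.1 hφ₁).1 p.1).hasDerivAt
  have h₂ := ((contDiff_infty_iff_deriv.1 hφ₂).1 p.1).hasDerivAt
  have hw : HasFDerivAt (fun q : ℝ × ℝ × ℝ => q.2.1)
      ((ContinuousLinearMap.fst ℝ ℝ ℝ).comp (ContinuousLinearMap.snd ℝ ℝ (ℝ × ℝ))) p :=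
    ((ContinuousLinearMap.fst ℝ ℝ ℝ).comp
      (ContinuousLinearMap.snd ℝ ℝ (ℝ × ℝ))).hasFDerivAt
  have hx : HasFDerivAt (fun q : ℝ × ℝ × ℝ => q.2.2)
      ((ContinuousLinearMap.snd ℝ ℝ ℝ).comp (ContinuousLinearMap.snd ℝ ℝ (ℝ × ℝ))) p :=
    ((ContinuousLinearMap.snd ℝ ℝ ℝ).comp
      (ContinuousLinearMap.snd ℝ ℝ (ℝ × ℝ))).hasFDerivAt
  have hden : 4 * T ^ 2 * deriv φ p.1 ^ 2 ≠ 0 := by positivity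
  have h : HasFDerivAt (Φmap T φ) _ p := (hd h₀).prodMk
    ((hw.sub (hd ((h₁.log hp).div_const (2 * T)))).prodMk
      ((hx.mul (hd (h₁.fun_inv hp))).add
        (hd (h₂.fun_div ((h₁.fun_pow 2).const_mul (4 * T ^ 2)) hden))))
  rw [h.fderiv]
  ext
  · simp
  · simp
    field_simp
    simp
  · simp
    field_simp
    ring

/-- The coordinate transformation `Φ` pulls back the metric `g_{f,f₁}` to `g_{F,F₁}`:
the form-preserving transformation underlying the normalization of the free function
in the main theorem. -/
theorem pullback_isometry
    (T C : ℝ) (hT : T ≠ 0) (φ : ℝ → ℝ) (hφ : ContDiff ℝ (⊤ : ℕ∞) φ)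
    (hφ' : ∀ U : ℝ, 0 < deriv φ U)
    (f f₁ : ℝ → ℝ) (hf : ContDiff ℝ (⊤ : ℕ∞) f) (hf₁ : ContDiff ℝ (⊤ : ℕ∞) f₁) :
    ∀ (p X Y : ℝ × ℝ × ℝ),
      gMet T C f f₁ (Φmap T φ p) (fderiv ℝ (Φmap T φ) p X) (fderiv ℝ (Φmap T φ) p Y)
        = gMet T C (Ftrans T C φ f) (F₁trans T C φ f f₁) p X Y := by
  intro p X Y
  have hp : deriv φ p.1 ≠ 0 := (hφ' p.1).ne'
  have hexp : exp (4 * T * (p.2.1 - log (deriv φ p.1) / (2 * T)))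
      = exp (4 * T * p.2.1) / deriv φ p.1 ^ 2 := by
    rw [show 4 * T * (p.2.1 - log (deriv φ p.1) / (2 * T))
        = 4 * T * p.2.1 - (log (deriv φ p.1) + log (deriv φ p.1)) by field_simp; ring,
      exp_sub, exp_add, exp_log (hφ' p.1), sq]
  rw [fderiv_Φmap_apply hT hφ p X hp, fderiv_Φmap_apply hT hφ p Y hp]
  simp only [gMet, aMet, Φmap, F₁trans, Ftrans, hexp]
  field_simp
  ring
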